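/- arXiv:2008.06314 — 3 statements merged into one kernel-verified Lean document; each statement's English description precedes it below -/
import Mathlib

section
/- Let A, B be closed subsets of a Hilbert space satisfying: there exists α ∈ (0,1) such that for all x ∈ A\B and all y ∈ B with d(y,A) > d(A,B), max{ d((x−y)/‖x−y‖, N_B(y)), d((y−x)/‖x−y‖, N_A(x)) } ≥ α (Condition 1). Suppose d(A,B) > 0 and let (x_n) be an alternating projection sequence with x_0 ∈ A, x_{2n+1} ∈ P_B(x_{2n}), x_{2n+2} ∈ P_A(x_{2n+1}). If d(x_{2n+1}, A) > d(A,B) for some n ≥ 0, then d(A,B) < (1−α²)^{n+1} ‖x_1 − x_0‖. -/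
open Metric
open scoped InnerProductSpace

variable {X : Type*} [NormedAddCommGroup X] [InnerProductSpace ℝ X] [CompleteSpace X]

/-- The cone `ℝ₊(u) = {λ u : λ ≥ 0}`. -/
def ray (u : X) : Set X := {w | ∃ l : ℝ, 0 ≤ l ∧ w = l • u}

/-- The proximal normal cone to `A` at `x`:
`{λ (y - x) : λ ≥ 0, x is a closest point of A to y}`. -/
def proxCone (A : Set X) (x : X) : Set X :=
  {v | ∃ (l : ℝ) (y : X), 0 ≤ l ∧ dist y x = Metric.infDist y A ∧ v = l • (y - x)}

/-- The distance between two sets: `d(A,B) = inf {‖a - b‖ : a ∈ A, b ∈ B}`. -/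
noncomputable def setDist (A B : Set X) : ℝ := sInf {r | ∃ a ∈ A, ∃ b ∈ B, r = dist a b}

theorem aux_select (A : Set X) (g : X → ℝ) (a : X) (e : ℝ) :
    ∃ z, (a ∈ A → 0 < e → (∃ m, ∀ u ∈ A, m ≤ g u) →
      z ∈ A ∧ g z ≤ g a ∧ ∀ u ∈ A, g z ≤ g u + e) := by
  by_cases h : a ∈ A ∧ 0 < e ∧ (∃ m, ∀ u ∈ A, m ≤ g u)
  · obtain ⟨ha, he, m, hm⟩ := h
    have hbdd : BddBelow (g '' A) := ⟨m, by rintro _ ⟨u, hu, rfl⟩; exact hm u hu⟩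
    have hne : (g '' A).Nonempty := ⟨_, a, ha, rfl⟩
    obtain ⟨_, ⟨z, hz, rfl⟩, hlt⟩ := exists_lt_of_csInf_lt hne (lt_add_of_pos_right (sInf (g '' A)) he)
    have hz2 : ∀ u ∈ A, g z ≤ g u + e := fun u hu => by
      have := csInf_le hbdd ⟨u, hu, rfl⟩
      linarith
    by_cases hza : g z ≤ g a
    · exact ⟨z, fun _ _ _ => ⟨hz, hza, hz2⟩⟩
    · refine ⟨a, fun _ _ _ => ⟨ha, le_rfl, fun u hu => ?_⟩⟩
      have := hz2 u hu
      linarith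
  · exact ⟨a, fun h1 h2 h3 => absurd ⟨h1, h2, h3⟩ h⟩

theorem aux_seq (A : Set X) (f : X → ℝ) (hf : Continuous f) (m : ℝ) (hm : ∀ u ∈ A, m ≤ f u)
    (a : X) (ha : a ∈ A) (c : ℝ) (hc : 0 < c) :
    ∃ (G : ℕ → X → ℝ) (z : ℕ → X), G 0 = f ∧ f (z 0) ≤ f a ∧ (∀ k, z k ∈ A) ∧
      (∀ k, Continuous (G k)) ∧
      (∀ k u, G (k+1) u = G k u + c * (1/2)^k * ‖u - z k‖^2) ∧
      (∀ k, G (k+1) (z (k+1)) ≤ G k (z k)) ∧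
      (∀ k, ∀ u ∈ A, G k (z k) ≤ G k u + c * (1/8)^k) := by
  choose s hs using fun (p : (X → ℝ) × X) (e : ℝ) => aux_select A p.1 p.2 e
  let P : ℕ → (X → ℝ) × X := fun k => Nat.rec (f, a) (fun k p =>
    (fun u => p.1 u + c * (1/2)^k * ‖u - s p (c * (1/8)^k)‖^2, s p (c * (1/8)^k))) k
  have hP : ∀ k, P (k+1) = (fun u => (P k).1 u + c * (1/2)^k * ‖u - s (P k) (c * (1/8)^k)‖^2,
    s (P k) (c * (1/8)^k)) := fun k => rfl
  have hinv : ∀ k, (P k).2 ∈ A ∧ (∀ u ∈ A, m ≤ (P k).1 u) ∧ Continuous (P k).1 := by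
    intro k
    induction k with
    | zero => exact ⟨ha, hm, hf⟩
    | succ k ih =>
      obtain ⟨h1, h2, h3⟩ := ih
      have := hs (P k) (c * (1/8)^k) h1 (by positivity) ⟨m, h2⟩
      rw [hP]
      refine ⟨this.1, fun u hu => ?_, by fun_prop⟩
      have h4 := h2 u hu
      have : 0 ≤ c * (1/2)^k * ‖u - s (P k) (c * (1/8)^k)‖^2 := by positivity
      simp only
      linarith
  have hk : ∀ k, _ := fun k => hs (P k) (c * (1/8)^k) (hinv k).1 (by positivity) ⟨m, (hinv k).2.1⟩
  refine ⟨fun k => (P k).1, fun k => (P (k+1)).2, rfl, (hk 0).2.1, fun k => (hk k).1,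
    fun k => (hinv k).2.2, fun k u => rfl, fun k => ?_, fun k => (hk k).2.2⟩
  refine (hk (k+1)).2.1.trans ?_
  simp [hP]

theorem aux_vp (A : Set X) (hA : IsClosed A) (f : X → ℝ) (hf : Continuous f) (m : ℝ)
    (hm : ∀ u ∈ A, m ≤ f u) (a : X) (ha : a ∈ A) (c : ℝ) (hc : 0 < c) :
    ∃ b ∈ A, ∃ w : X, ‖w‖ ≤ 2 * c ∧ f b ≤ f a ∧
      ∀ u ∈ A, f b ≤ f u + 2 * c * ‖u - b‖^2 + 2 * ⟪w, u - b⟫_ℝ := by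
  obtain ⟨G, z, hG0, hz0, hzA, hGc, hGs, hdec, hmin⟩ := aux_seq A f hf m hm a ha c hc
  have hanti : Antitone fun k => G k (z k) := antitone_nat_of_succ_le hdec
  have hmono : ∀ u, Monotone fun k => G k u := fun u => monotone_nat_of_le_succ fun k => by
    rw [hGs]
    have : 0 ≤ c * (1/2)^k * ‖u - z k‖^2 := by positivity
    linarith
  have hle : ∀ k j, k + 1 ≤ j → G (k+1) (z j) ≤ G k (z k) := fun k j hkj =>
    (hmono (z j) hkj).trans (hanti (by omega : k ≤ j))
  have hclose : ∀ k, ∀ u ∈ A, G (k+1) u ≤ G k (z k) → ‖u - z k‖ ≤ (1/2)^k := by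
    intro k u hu h
    rw [hGs] at h
    have h2 := hmin k u hu
    have h3 : c * (1/2)^k * ‖u - z k‖^2 ≤ c * (1/2)^k * ((1/2)^k)^2 := by
      have : c * (1/2:ℝ)^k * ((1/2)^k)^2 = c * (1/8)^k := by
        rw [mul_assoc, ← pow_mul, ← pow_add, show k + k * 2 = 3 * k by ring, pow_mul]; norm_num
      linarith
    have h4 := le_of_mul_le_mul_left h3 (by positivity)
    exact le_of_sq_le_sq h4 (by positivity)
  have hcau : CauchySeq z := by
    refine cauchySeq_of_le_geometric (1/2) 1 (by norm_num) fun k => ?_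
    rw [dist_comm, dist_eq_norm, one_mul]
    exact hclose k _ (hzA _) (hle k _ le_rfl)
  obtain ⟨b, hb⟩ := cauchySeq_tendsto_of_complete hcau
  have hbA : b ∈ A := hA.mem_of_tendsto hb (Filter.Eventually.of_forall hzA)
  have hGb : ∀ k, G (k+1) b ≤ G k (z k) := fun k =>
    le_of_tendsto (((hGc (k+1)).tendsto b).comp hb)
      (Filter.eventually_atTop.2 ⟨k+1, fun j hj => hle k j hj⟩)
  have hbz : ∀ k, ‖b - z k‖ ≤ (1/2)^k := fun k => hclose k b hbA (hGb k)
  have hsumc : HasSum (fun k : ℕ => c * (1/2:ℝ)^k) (2 * c) := by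
    have := hasSum_geometric_two.mul_left c
    rwa [mul_comm c 2] at this
  have hnb : ∀ k : ℕ, ‖(c * (1/2:ℝ)^k) • (b - z k)‖ ≤ c * (1/2)^k := by
    intro k
    rw [norm_smul, Real.norm_of_nonneg (by positivity)]
    have h1 : ‖b - z k‖ ≤ 1 := (hbz k).trans (pow_le_one₀ (by norm_num) (by norm_num))
    exact mul_le_of_le_one_right (by positivity) h1
  have hsw : Summable fun k : ℕ => (c * (1/2:ℝ)^k) • (b - z k) :=
    Summable.of_norm_bounded hsumc.summable hnb
  refine ⟨b, hbA, ∑' k : ℕ, (c * (1/2:ℝ)^k) • (b - z k), tsum_of_norm_bounded hsumc hnb, ?_, ?_⟩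
  · have h1 := hGb 0
    have h2 := hmono b (Nat.zero_le 1)
    simp only [hG0, zero_add] at h1 h2
    linarith
  · intro u hu
    have hform : ∀ k, G k u - G k b = f u - f b +
        (∑ j ∈ Finset.range k, c * (1/2:ℝ)^j) * ‖u - b‖^2 +
        2 * ⟪∑ j ∈ Finset.range k, (c * (1/2:ℝ)^j) • (b - z j), u - b⟫_ℝ := by
      intro k
      induction k with
      | zero => simp [hG0]
      | succ k ih =>
        rw [hGs, hGs, Finset.sum_range_succ, Finset.sum_range_succ, inner_add_left,
          real_inner_smul_left]
        have : ‖u - z k‖^2 = ‖u - b‖^2 + 2 * ⟪b - z k, u - b⟫_ℝ + ‖b - z k‖^2 := by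
          rw [show u - z k = (u - b) + (b - z k) by abel, norm_add_sq_real, real_inner_comm]
        rw [this]
        linear_combination ih
    have hk : ∀ k, f b ≤ f u + (∑ j ∈ Finset.range k, c * (1/2:ℝ)^j) * ‖u - b‖^2 +
        2 * ⟪∑ j ∈ Finset.range k, (c * (1/2:ℝ)^j) • (b - z j), u - b⟫_ℝ + c * (1/8)^k := by
      intro k
      have h1 := hform k
      have h2 := hGb k
      have h3 := hmin k u hu
      have h4 := hmono b (Nat.le_succ k)
      simp only [Nat.succ_eq_add_one] at h4
      linarith
    have t1 := hsumc.tendsto_sum_nat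
    have t2 := hsw.hasSum.tendsto_sum_nat
    have t3 : Filter.Tendsto (fun k : ℕ => c * (1/8:ℝ)^k) Filter.atTop (nhds (c * 0)) :=
      (tendsto_pow_atTop_nhds_zero_of_lt_one (by norm_num) (by norm_num)).const_mul c
    have t4 := (((t1.mul_const (‖u - b‖^2)).const_add (f u)).add
      ((t2.inner (tendsto_const_nhds (x := u - b)) (𝕜 := ℝ)).const_mul 2)).add t3
    have := ge_of_tendsto' t4 hk
    simpa using this

/-- semiconcavity of sqrt(norm^2 + e^2) -/
theorem aux_semi (v h : X) (e s : ℝ) (hs : 0 < s) (hse : s ^ 2 = ‖v‖^2 + e^2) :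
    √(‖v + h‖^2 + e^2) ≤ s + s⁻¹ * ⟪v, h⟫_ℝ + (2*s)⁻¹ * ‖h‖^2 := by
  have h1 : ‖v + h‖^2 + e^2 = s^2 + 2 * ⟪v, h⟫_ℝ + ‖h‖^2 := by
    rw [norm_add_sq_real]; linarith
  set r := √(‖v + h‖^2 + e^2) with hr
  have h2 : r^2 = s^2 + 2 * ⟪v, h⟫_ℝ + ‖h‖^2 := by
    rw [hr, Real.sq_sqrt (by positivity), h1]
  have h3 : s + s⁻¹ * ⟪v, h⟫_ℝ + (2*s)⁻¹ * ‖h‖^2 = (2*s)⁻¹ * (s^2 + r^2) := by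
    rw [h2]; field_simp; ring
  rw [h3, inv_mul_eq_div, le_div_iff₀ (by positivity)]
  nlinarith [sq_nonneg (r - s)]

theorem aux_prox (A : Set X) (b p : X) (hb : b ∈ A) (K : ℝ) (hK : 0 < K)
    (h : ∀ u ∈ A, ⟪p, u - b⟫_ℝ ≤ K * ‖u - b‖^2) : p ∈ proxCone A b := by
  refine ⟨2 * K, b + (2*K)⁻¹ • p, by positivity, ?_, ?_⟩
  · refine le_antisymm ?_ (infDist_le_dist_of_mem hb)
    refine (le_infDist ⟨b, hb⟩).2 fun u hu => ?_
    rw [dist_eq_norm, dist_eq_norm]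
    refine le_of_sq_le_sq ?_ (norm_nonneg _)
    have h1 := h u hu
    rw [show b + (2*K)⁻¹ • p - u = (2*K)⁻¹ • p - (u - b) by abel, add_sub_cancel_left,
      norm_sub_sq_real, real_inner_smul_left]
    have : 2 * ((2*K)⁻¹ * ⟪p, u - b⟫_ℝ) ≤ ‖u - b‖^2 := by
      rw [show 2 * ((2*K)⁻¹ * ⟪p, u - b⟫_ℝ) = ⟪p, u - b⟫_ℝ / K by field_simp,
        div_le_iff₀ hK]
      linarith
    linarith
  · rw [add_sub_cancel_left, smul_smul, mul_inv_cancel₀ (by positivity), one_smul]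

theorem aux_cone (p q : X) (α : ℝ) (hp : 0 < ‖p‖) (hq : 0 < ‖q‖) (h0 : 0 < α) (h1 : α < 1)
    (h : ‖p - q‖ < α * ‖q‖) : ∃ l : ℝ, 0 ≤ l ∧ ‖‖p‖⁻¹ • p - l • q‖ < α := by
  have e1 := norm_sub_sq_real p q
  have e2 : ‖p - q‖^2 < α^2 * ‖q‖^2 := by
    rw [← mul_pow]; exact pow_lt_pow_left₀ h (norm_nonneg _) (by norm_num)
  have hin : 0 < ⟪p, q⟫_ℝ := by
    have : α^2 * ‖q‖^2 ≤ ‖q‖^2 := mul_le_of_le_one_left (by positivity) (by nlinarith)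
    nlinarith
  refine ⟨⟪p, q⟫_ℝ / (‖p‖ * ‖q‖^2), by positivity, ?_⟩
  refine lt_of_pow_lt_pow_left₀ 2 h0.le ?_
  set i := ⟪p, q⟫_ℝ with hi
  have e3 : ‖‖p‖⁻¹ • p - (i / (‖p‖ * ‖q‖^2)) • q‖^2 = 1 - (i / (‖p‖ * ‖q‖))^2 := by
    rw [norm_sub_sq_real, norm_smul, norm_smul, real_inner_smul_left, real_inner_smul_right, ← hi,
      mul_pow, mul_pow, Real.norm_eq_abs, Real.norm_eq_abs, sq_abs, sq_abs]
    field_simp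
    ring
  rw [e3]
  set t := i / (‖p‖ * ‖q‖) with ht
  have e4 : i = t * (‖p‖ * ‖q‖) := by rw [ht]; field_simp
  rw [e4] at e1
  have e5 : ‖q‖^2 * (1 - t^2) < ‖q‖^2 * α^2 := by nlinarith [sq_nonneg (‖p‖ - t * ‖q‖)]
  exact lt_of_mul_lt_mul_left e5 (by positivity)

theorem aux_step (A B : Set X) (hA : IsClosed A)
    (α : ℝ) (hα : α ∈ Set.Ioo (0 : ℝ) 1)
    (hcond1 : ∀ x ∈ A, x ∉ B → ∀ y ∈ B, setDist A B < Metric.infDist y A →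
      α ≤ max (Metric.infDist (‖x - y‖⁻¹ • (x - y)) (proxCone B y))
              (Metric.infDist (‖x - y‖⁻¹ • (y - x)) (proxCone A x)))
    (hd : 0 < setDist A B) (a y : X) (ha : a ∈ A) (hy : y ∈ B)
    (hay : dist a y = infDist a B) (hgt : setDist A B < infDist y A) :
    infDist y A ≤ (1 - α^2) * dist a y := by
  obtain ⟨hα0, hα1⟩ := hα
  by_contra! hcon
  set D := infDist y A with hD
  have hDle : ∀ u ∈ A, D ≤ ‖u - y‖ := fun u hu => by
    rw [← dist_eq_norm, dist_comm]; exact infDist_le_dist_of_mem hu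
  have hD0 : 0 < D := hd.trans hgt
  rw [dist_eq_norm] at hcon
  set ρ := ‖a - y‖ with hρ
  have hρ0 : 0 < ρ := hD0.trans_le (hDle a ha)
  have hDρ : D ≤ ρ := hDle a ha
  obtain ⟨β, hβ1, hβα⟩ : ∃ β, (ρ - D) / (α * ρ) < β ∧ β < α := exists_between (by
    rw [div_lt_iff₀ (by positivity)]; nlinarith)
  have hβ0 : 0 < β := lt_of_le_of_lt (div_nonneg (by linarith) (by positivity)) hβ1
  rw [div_lt_iff₀ (by positivity)] at hβ1
  obtain ⟨e, he0, he⟩ : ∃ e, 0 < e ∧ ρ - D + β * e < β * (α * ρ) := by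
    refine ⟨(β * (α * ρ) - (ρ - D)) / (2 * β), div_pos (by linarith) (by positivity), ?_⟩
    have : β * ((β * (α * ρ) - (ρ - D)) / (2 * β)) = (β * (α * ρ) - (ρ - D)) / 2 := by field_simp
    rw [this]; linarith
  obtain ⟨b, hbA, w, hw, hfb, hvp⟩ := aux_vp A hA
    (fun u => ‖u - y‖ + β * √(‖u - a‖^2 + e^2)) (by fun_prop) 0 (fun u _ => by positivity) a ha
    ((α - β) / 8) (by linarith)
  set s := √(‖b - a‖^2 + e^2) with hs
  have hs2 : s^2 = ‖b - a‖^2 + e^2 := Real.sq_sqrt (by positivity)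
  have hs0 : 0 < s := Real.sqrt_pos.2 (by positivity)
  have hbs : ‖b - a‖ ≤ s := Real.le_sqrt_of_sq_le (by nlinarith [sq_nonneg e])
  have hnear : ‖b - a‖ < α * ρ := by
    have h1 : ‖b - y‖ + β * s ≤ ρ + β * e := by
      simpa [Real.sqrt_sq he0.le] using hfb
    have h2 := hDle b hbA
    have h3 : β * s < β * (α * ρ) := by linarith
    exact hbs.trans_lt (lt_of_mul_lt_mul_left h3 hβ0.le)
  have hby : 0 < ‖b - y‖ := hD0.trans_le (hDle b hbA)
  have hbB : b ∉ B := fun hbB => by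
    have : setDist A B ≤ 0 := csInf_le ⟨0, by rintro _ ⟨_, _, _, _, rfl⟩; exact dist_nonneg⟩
      ⟨b, hbA, b, hbB, (dist_self b).symm⟩
    linarith
  have hmain := hcond1 b hbA hbB y hy hgt
  have hfirst : infDist (‖b - y‖⁻¹ • (b - y)) (proxCone B y) < α := by
    obtain ⟨l, hl, hlt⟩ := aux_cone (b - y) (a - y) α hby hρ0 hα0 hα1 (by simpa using hnear)
    refine lt_of_le_of_lt (infDist_le_dist_of_mem (y := l • (a - y)) ⟨l, a, hl, hay, rfl⟩) ?_
    rwa [dist_eq_norm]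
  have hsecond : infDist (‖b - y‖⁻¹ • (y - b)) (proxCone A b) < α := by
    have hmem : ‖b - y‖⁻¹ • (y - b) - ((β * s⁻¹) • (b - a) + (2:ℝ) • w) ∈ proxCone A b := by
      refine aux_prox A b _ hbA ((2 * ‖b-y‖)⁻¹ + β * (2*s)⁻¹ + 2 * ((α - β)/8)) ?_ fun u hu => ?_
      · have : 0 < (α - β)/8 := by linarith
        positivity
      · have h1 := hvp u hu
        have h2 := aux_semi (b - a) (u - b) e s hs0 hs2
        have h3 := aux_semi (b - y) (u - b) 0 ‖b - y‖ hby (by simp)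
        have h4 := mul_le_mul_of_nonneg_left h2 hβ0.le
        rw [show b - a + (u - b) = u - a by abel] at h4
        rw [show b - y + (u - b) = u - y by abel] at h3
        simp only [ne_eq, OfNat.ofNat_ne_zero, not_false_eq_true, zero_pow, add_zero,
          Real.sqrt_sq (norm_nonneg _)] at h3
        rw [← neg_sub b y]
        simp only [inner_sub_left (𝕜 := ℝ) _ _ (u - b), inner_add_left, real_inner_smul_left, inner_neg_left, smul_neg] at h1 h3 h4 ⊢
        nlinarith
    refine lt_of_le_of_lt (infDist_le_dist_of_mem hmem) ?_
    rw [dist_eq_norm, sub_sub_cancel]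
    refine lt_of_le_of_lt (norm_add_le _ _) ?_
    rw [norm_smul, norm_smul, Real.norm_of_nonneg (by positivity), Real.norm_of_nonneg (by positivity)]
    have : β * s⁻¹ * ‖b - a‖ ≤ β := by
      rw [mul_assoc, inv_mul_eq_div]
      exact mul_le_of_le_one_right hβ0.le ((div_le_one hs0).2 hbs)
    linarith
  exact absurd hmain (not_le.2 (max_lt hfirst hsecond))

theorem stmt_9 (A B : Set X) (hA : IsClosed A) (hB : IsClosed B)
    (α : ℝ) (hα : α ∈ Set.Ioo (0 : ℝ) 1)
    (hcond1 : ∀ x ∈ A, x ∉ B → ∀ y ∈ B, setDist A B < Metric.infDist y A →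
      α ≤ max (Metric.infDist (‖x - y‖⁻¹ • (x - y)) (proxCone B y))
              (Metric.infDist (‖x - y‖⁻¹ • (y - x)) (proxCone A x)))
    (hd : 0 < setDist A B)
    (x : ℕ → X) (hx0 : x 0 ∈ A)
    (hodd : ∀ n, x (2 * n + 1) ∈ B ∧
      dist (x (2 * n)) (x (2 * n + 1)) = Metric.infDist (x (2 * n)) B)
    (heven : ∀ n, x (2 * n + 2) ∈ A ∧
      dist (x (2 * n + 1)) (x (2 * n + 2)) = Metric.infDist (x (2 * n + 1)) A)
    (n : ℕ) (hnot : setDist A B < Metric.infDist (x (2 * n + 1)) A) :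
    setDist A B < (1 - α ^ 2) ^ (n + 1) * ‖x 1 - x 0‖ := by
  have hxA : ∀ k, x (2 * k) ∈ A := by
    intro k
    cases k with
    | zero => exact hx0
    | succ k => exact (heven k).1
  have hmono : ∀ k, infDist (x (2 * (k+1) + 1)) A ≤ infDist (x (2 * k + 1)) A := by
    intro k
    have h1 : infDist (x (2 * (k+1) + 1)) A ≤ dist (x (2 * (k+1))) (x (2 * (k+1) + 1)) := by
      rw [dist_comm]; exact infDist_le_dist_of_mem (hxA (k+1))
    have h2 := (hodd (k+1)).2
    have h3 : infDist (x (2 * (k+1))) B ≤ dist (x (2*k+2)) (x (2*k+1)) :=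
      infDist_le_dist_of_mem (hodd k).1
    rw [dist_comm, (heven k).2] at h3
    linarith
  have hα2 : 0 ≤ 1 - α^2 := by nlinarith [hα.1, hα.2]
  have key : ∀ k, setDist A B < infDist (x (2 * k + 1)) A →
      infDist (x (2 * k + 1)) A ≤ (1 - α ^ 2) ^ (k + 1) * ‖x 1 - x 0‖ := by
    intro k
    induction k with
    | zero =>
      intro h
      have := aux_step A B hA α hα hcond1 hd _ _ (hxA 0) (hodd 0).1 (hodd 0).2 h
      rw [dist_comm, dist_eq_norm] at this
      simpa using this
    | succ k ih =>
      intro h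
      have h1 := aux_step A B hA α hα hcond1 hd _ _ (hxA (k+1)) (hodd (k+1)).1 (hodd (k+1)).2 h
      have h2 := ih (h.trans_le (hmono k))
      have h3 : infDist (x (2 * (k+1))) B ≤ dist (x (2*k+2)) (x (2*k+1)) :=
        infDist_le_dist_of_mem (hodd k).1
      rw [dist_comm, (heven k).2] at h3
      rw [(hodd (k+1)).2] at h1
      calc _ ≤ _ := h1
        _ ≤ (1 - α^2) * ((1 - α ^ 2) ^ (k + 1) * ‖x 1 - x 0‖) :=
          mul_le_mul_of_nonneg_left (h3.trans h2) hα2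
        _ = _ := by ring
  exact hnot.trans_le (key n hnot)
end

section
/- Let A, B be closed subsets of a Hilbert space with d(A,B) > 0 satisfying Condition 1 with constant α ∈ (0,1). Then any alternating projection sequence starting at x_0 ∈ A attains the minimum distance (i.e., d(x_{2n+1},A) = d(A,B)) in at most 2N+1 steps, where N = ⌊log_{1−α²}(d(A,B)/d(x_0,B))⌋. -/
open Metric
open scoped InnerProductSpace

variable {X : Type*} [NormedAddCommGroup X] [InnerProductSpace ℝ X] [CompleteSpace X]

lemma aux_step_s10 {X : Type*} [NormedAddCommGroup X] [InnerProductSpace ℝ X]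
    (A : Set X) (R η : ℝ) (hR : 0 < R) (hη : 0 < η) (x z : X) (hx : x ∈ A)
    (hxz : ‖x - z‖ ≤ R) (hm : ∀ u ∈ A, ‖x - z‖ ^ 2 ≤ ‖u - z‖ ^ 2 + η ^ 3 / R) :
    ∃ x1 z1 : X, x1 ∈ A ∧ ‖x1 - z1‖ ≤ R ∧
      (∀ u ∈ A, ‖x1 - z1‖ ^ 2 ≤ ‖u - z1‖ ^ 2 + (η / 2) ^ 3 / R) ∧
      ‖x - x1‖ ≤ η ∧ ‖z - z1‖ ≤ η := by
  set δ := η / R with hδ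
  have hδ0 : 0 < δ := by positivity
  set t := δ / (1 + δ) with ht
  have ht0 : 0 < t := by positivity
  have ht1 : t < 1 := by rw [ht, div_lt_one (by positivity)]; linarith
  have htδ : t ≤ δ := by
    rw [ht, div_le_iff₀ (by positivity)]; nlinarith
  set z1 := z + t • (x - z) with hz1
  have hxz1 : ‖x - z1‖ ≤ R := by
    have : x - z1 = (1 - t) • (x - z) := by rw [hz1]; module
    rw [this, norm_smul, Real.norm_eq_abs, abs_of_pos (by linarith)]
    nlinarith [norm_nonneg (x - z)]
  have hzz1 : ‖z - z1‖ ≤ η := by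
    have : z - z1 = (-t) • (x - z) := by rw [hz1]; module
    rw [this, norm_smul, Real.norm_eq_abs, abs_neg, abs_of_pos ht0]
    calc t * ‖x - z‖ ≤ δ * R := by gcongr
      _ = η := by rw [hδ]; field_simp
  have hid : ∀ u : X, ‖u - z1‖ ^ 2 = (1 - t) * ‖u - z‖ ^ 2 + t * ‖u - x‖ ^ 2
      - t * (1 - t) * ‖x - z‖ ^ 2 := by
    intro u
    have e1 : u - z1 = (u - z) - t • (x - z) := by rw [hz1]; module
    have e2 : u - x = (u - z) - (x - z) := by module
    rw [e1, e2, norm_sub_sq_real (u - z) (t • (x - z)), norm_sub_sq_real (u - z) (x - z), norm_smul,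
      inner_smul_right, mul_pow,
      Real.norm_eq_abs, sq_abs]
    ring
  obtain ⟨x1, hx1, hle, happ⟩ : ∃ x1 ∈ A, ‖x1 - z1‖ ≤ ‖x - z1‖ ∧
      ∀ u ∈ A, ‖x1 - z1‖ ^ 2 ≤ ‖u - z1‖ ^ 2 + (η / 2) ^ 3 / R := by
    have he : 0 < (η / 2) ^ 3 / R := by positivity
    generalize (η / 2) ^ 3 / R = e at he
    have hbdd : BddBelow ((fun u => ‖u - z1‖ ^ 2) '' A) :=
      ⟨0, by rintro _ ⟨u, -, rfl⟩; positivity⟩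
    by_cases h : ∀ u ∈ A, ‖x - z1‖ ^ 2 ≤ ‖u - z1‖ ^ 2 + e
    · exact ⟨x, hx, le_rfl, h⟩
    · push Not at h
      obtain ⟨u0, hu0, hu0'⟩ := h
      obtain ⟨_, ⟨w, hw, rfl⟩, hw'⟩ := exists_lt_of_csInf_lt (Set.Nonempty.image _ ⟨x, hx⟩)
        (lt_add_of_pos_right (sInf ((fun u => ‖u - z1‖ ^ 2) '' A)) he)
      have hw2 : ∀ u ∈ A, ‖w - z1‖ ^ 2 ≤ ‖u - z1‖ ^ 2 + e := by
        intro u hu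
        have := csInf_le hbdd ⟨u, hu, rfl⟩
        simp only at this hw'
        linarith
      refine ⟨w, hw, ?_, hw2⟩
      have := hw2 u0 hu0
      exact le_of_sq_le_sq (by linarith) (norm_nonneg _)
  refine ⟨x1, z1, hx1, hle.trans hxz1, happ, ?_, hzz1⟩
  have h1 : ‖x1 - z1‖ ^ 2 ≤ ‖x - z1‖ ^ 2 := by gcongr
  rw [hid, hid x] at h1
  simp only [sub_self, norm_zero] at h1
  have h2 := hm x1 hx1
  rw [norm_sub_rev]
  refine le_of_sq_le_sq ?_ hη.le
  have h3 : t * ‖x1 - x‖ ^ 2 ≤ (1 - t) * (η ^ 3 / R) := by nlinarith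
  have h4 : (1 - t) * (η ^ 3 / R) = t * η ^ 2 := by
    have : 1 - t = 1 / (1 + δ) := by rw [ht]; field_simp; ring
    rw [this, ht, hδ]; field_simp
  rw [h4] at h3
  exact le_of_mul_le_mul_left h3 ht0

lemma aux_proj {X : Type*} [NormedAddCommGroup X] [InnerProductSpace ℝ X] [CompleteSpace X]
    (A : Set X) (hA : IsClosed A) (R η : ℝ) (hR : 0 < R) (hη : 0 < η) (x z : X) (hx : x ∈ A)
    (hxz : ‖x - z‖ ≤ R) (hm : ∀ u ∈ A, ‖x - z‖ ^ 2 ≤ ‖u - z‖ ^ 2 + η ^ 3 / R) :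
    ∃ x' z' : X, x' ∈ A ∧ ‖x - x'‖ ≤ 2 * η ∧ ‖z - z'‖ ≤ 2 * η ∧
      ∀ u ∈ A, ‖x' - z'‖ ≤ ‖u - z'‖ := by
  let P : ℕ → X × X → Prop := fun n p => p.1 ∈ A ∧ ‖p.1 - p.2‖ ≤ R ∧
    ∀ u ∈ A, ‖p.1 - p.2‖ ^ 2 ≤ ‖u - p.2‖ ^ 2 + (η / 2 ^ n) ^ 3 / R
  have step : ∀ n (p : X × X), ∃ q : X × X, P n p → P (n + 1) q ∧
      ‖p.1 - q.1‖ ≤ η / 2 ^ n ∧ ‖p.2 - q.2‖ ≤ η / 2 ^ n := by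
    intro n p
    by_cases hp : P n p
    · obtain ⟨x1, z1, h1, h2, h3, h4, h5⟩ := aux_step_s10 A R (η / 2 ^ n) hR (by positivity)
        p.1 p.2 hp.1 hp.2.1 hp.2.2
      refine ⟨(x1, z1), fun _ => ⟨⟨h1, h2, ?_⟩, h4, h5⟩⟩
      intro u hu
      have := h3 u hu
      rwa [div_div, ← pow_succ] at this
    · exact ⟨p, fun h => absurd h hp⟩
  choose f hf using step
  let s : ℕ → X × X := fun n => Nat.rec (x, z) (fun n p => f n p) n
  have hs : ∀ n, P n (s n) := by
    intro n
    induction n with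
    | zero => exact ⟨hx, hxz, by
        change ∀ u ∈ A, ‖x - z‖ ^ 2 ≤ ‖u - z‖ ^ 2 + (η / 2 ^ 0) ^ 3 / R
        simpa using hm⟩
    | succ n ih => exact (hf n _ ih).1
  have d1 : ∀ n, dist ((s n).1) ((s (n + 1)).1) ≤ 2 * η / 2 / 2 ^ n := by
    intro n
    rw [dist_eq_norm, mul_div_cancel_left₀ _ two_ne_zero]
    exact (hf n _ (hs n)).2.1
  have d2 : ∀ n, dist ((s n).2) ((s (n + 1)).2) ≤ 2 * η / 2 / 2 ^ n := by
    intro n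
    rw [dist_eq_norm, mul_div_cancel_left₀ _ two_ne_zero]
    exact (hf n _ (hs n)).2.2
  obtain ⟨x', hx'⟩ := cauchySeq_tendsto_of_complete (cauchySeq_of_le_geometric_two d1)
  obtain ⟨z', hz'⟩ := cauchySeq_tendsto_of_complete (cauchySeq_of_le_geometric_two d2)
  refine ⟨x', z', hA.mem_of_tendsto hx' (Filter.Eventually.of_forall fun n => (hs n).1), ?_, ?_, ?_⟩
  · have := dist_le_of_le_geometric_two_of_tendsto₀ d1 hx'
    rwa [dist_eq_norm] at this
  · have := dist_le_of_le_geometric_two_of_tendsto₀ d2 hz'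
    rwa [dist_eq_norm] at this
  · intro u hu
    refine le_of_sq_le_sq ?_ (norm_nonneg _)
    have l1 := ((hx'.sub hz').norm.pow 2)
    have l0 : Filter.Tendsto (fun n : ℕ => η / 2 ^ n) Filter.atTop (nhds 0) := by
      have := (tendsto_pow_atTop_nhds_zero_of_lt_one (r := (1 / 2 : ℝ)) (by norm_num)
        (by norm_num)).const_mul η
      simpa [div_eq_mul_inv] using this
    have l2 := (((tendsto_const_nhds (x := u)).sub hz').norm.pow 2).add ((l0.pow 3).div_const R)
    have := le_of_tendsto_of_tendsto' l1 l2 (fun n => (hs n).2.2 u hu)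
    simpa using this

set_option maxHeartbeats 2000000 in
lemma aux_key {X : Type*} [NormedAddCommGroup X] [InnerProductSpace ℝ X] [CompleteSpace X]
    (A : Set X) (hA : IsClosed A) (α s : ℝ) (h0 : 0 < α) (x0 y : X) (hx0 : x0 ∈ A)
    (hs : 0 < s) (hsA : ∀ u ∈ A, s ≤ ‖u - y‖) (hα1 : α < 1)
    (hlt : (1 - α ^ 2) * ‖x0 - y‖ < s) :
    ∃ x ∈ A, ‖x - x0‖ < α * ‖x0 - y‖ ∧
      Metric.infDist (‖x - y‖⁻¹ • (y - x)) (proxCone A x) < α := by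
  set r := ‖x0 - y‖ with hr
  have hsr : s ≤ r := hsA x0 hx0
  have hr0 : 0 < r := hs.trans_le hsr
  obtain ⟨a, ha0, haα, hag⟩ : ∃ a : ℝ, 0 < a ∧ a < α ∧ r - s < a * α * r := by
    obtain ⟨a, h1, h2⟩ := exists_between (show (r - s) / (α * r) < α by
      rw [div_lt_iff₀ (by positivity)]; nlinarith)
    refine ⟨a, lt_of_le_of_lt (div_nonneg (by linarith) (by positivity)) h1, h2, ?_⟩
    rw [div_lt_iff₀ (by positivity)] at h1
    linarith
  set γ := a * α * r - (r - s) with hγ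
  have hγ0 : 0 < γ := by linarith
  set δ := γ / (4 * a) with hδ
  have hδ0 : 0 < δ := by positivity
  have haδ : a * δ = γ / 4 := by rw [hδ]; field_simp
  obtain ⟨η, hη0, hη1, hη2⟩ : ∃ η : ℝ, 0 < η ∧ a * (2 * η) < γ / 2 ∧
      a + η * (8 / s + 4 * a / δ) < α := by
    have hM : 0 < 8 / s + 4 * a / δ := by positivity
    set M := 8 / s + 4 * a / δ
    refine ⟨min (γ / (8 * a)) ((α - a) / (2 * M)), lt_min (by positivity)
      (div_pos (by linarith) (by positivity)), ?_, ?_⟩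
    · have := min_le_left (γ / (8 * a)) ((α - a) / (2 * M))
      have h2 : a * (2 * (γ / (8 * a))) = γ / 4 := by field_simp; norm_num
      nlinarith
    · have := min_le_right (γ / (8 * a)) ((α - a) / (2 * M))
      have h2 : (α - a) / (2 * M) * M = (α - a) / 2 := by field_simp
      nlinarith
  obtain ⟨ε, hε0, hε1, hε2⟩ : ∃ ε : ℝ, 0 < ε ∧ ε ≤ γ / 4 ∧ ε * (4 * r) ≤ η ^ 3 / (2 * r) := by
    refine ⟨min (γ / 4) (η ^ 3 / (2 * r) / (4 * r)), by positivity, min_le_left _ _, ?_⟩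
    rw [← le_div_iff₀ (by positivity)]
    exact min_le_right _ _
  let ψ : X → ℝ := fun u => Real.sqrt (δ ^ 2 + ‖u - x0‖ ^ 2)
  have hψsq : ∀ u, ψ u ^ 2 = δ ^ 2 + ‖u - x0‖ ^ 2 := fun u => Real.sq_sqrt (by positivity)
  have hψδ : ∀ u, δ ≤ ψ u := fun u => Real.le_sqrt_of_sq_le (by nlinarith [sq_nonneg ‖u - x0‖])
  have hψn : ∀ u, ‖u - x0‖ ≤ ψ u := fun u => Real.le_sqrt_of_sq_le (by nlinarith [sq_nonneg δ])
  have hψ0 : ψ x0 = δ := by simp [ψ, Real.sqrt_sq hδ0.le]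
  let h : X → ℝ := fun u => ‖u - y‖ + a * ψ u
  obtain ⟨w, hw, hwm⟩ : ∃ w ∈ A, ∀ u ∈ A, h w ≤ h u + ε := by
    have hbdd : BddBelow (h '' A) :=
      ⟨0, by
        rintro _ ⟨u, -, rfl⟩
        have := hψδ u
        have : 0 ≤ ψ u := by linarith
        positivity⟩
    obtain ⟨_, ⟨w, hw, rfl⟩, hw'⟩ := exists_lt_of_csInf_lt (Set.Nonempty.image _ ⟨x0, hx0⟩)
        (lt_add_of_pos_right (sInf (h '' A)) hε0)
    refine ⟨w, hw, fun u hu => ?_⟩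
    have := csInf_le hbdd ⟨u, hu, rfl⟩
    linarith
  have hNs := hsA w hw
  have hρ : a * ‖w - x0‖ ≤ a * α * r - γ / 2 := by
    have h1 := hwm x0 hx0
    simp only [h, hψ0, haδ] at h1
    have h2 := mul_le_mul_of_nonneg_left (hψn w) ha0.le
    linarith
  have hρr : ‖w - x0‖ ≤ r := by
    have : a * ‖w - x0‖ ≤ a * r := by nlinarith [mul_pos ha0 hr0]
    exact le_of_mul_le_mul_left this ha0
  have hN2r : ‖w - y‖ ≤ 2 * r := by
    have := norm_sub_le_norm_sub_add_norm_sub w x0 y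
    linarith
  set N := ‖w - y‖ with hN
  have hN0 : 0 < N := hs.trans_le hNs
  set p := ψ w with hp
  have hpδ : δ ≤ p := hψδ w
  have hp0 : 0 < p := hδ0.trans_le hpδ
  set c1 := 1 / (2 * N) with hc1
  set c2 := a / (2 * p) with hc2
  have c10 : 0 < c1 := by positivity
  have c20 : 0 < c2 := by positivity
  set K := c1 + c2 with hK
  have hK0 : 0 < K := by positivity
  have c1l : 1 / (4 * r) ≤ c1 := by
    rw [hc1]; exact one_div_le_one_div_of_le (by positivity) (by linarith)
  have c1u : c1 ≤ 1 / (2 * s) := by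
    rw [hc1]; exact one_div_le_one_div_of_le (by positivity) (by linarith)
  have c2u : c2 ≤ a / (2 * δ) := by
    rw [hc2]; gcongr
  set z := w + K⁻¹ • (c1 • (y - w) + c2 • (x0 - w)) with hz
  have hKz : K • (z - w) = c1 • (y - w) + c2 • (x0 - w) := by
    rw [hz, add_sub_cancel_left, smul_inv_smul₀ hK0.ne']
  have hwz : ‖w - z‖ ≤ 2 * r := by
    have h1 : K * ‖w - z‖ ≤ K * (2 * r) := by
      calc K * ‖w - z‖ = ‖K • (z - w)‖ := by
            rw [norm_smul, Real.norm_eq_abs, abs_of_pos hK0, norm_sub_rev]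
        _ ≤ ‖c1 • (y - w)‖ + ‖c2 • (x0 - w)‖ := by rw [hKz]; exact norm_add_le _ _
        _ = c1 * N + c2 * ‖w - x0‖ := by
            rw [norm_smul, norm_smul, Real.norm_eq_abs, Real.norm_eq_abs, abs_of_pos c10,
              abs_of_pos c20, norm_sub_rev y, norm_sub_rev x0]
        _ ≤ c1 * (2 * r) + c2 * (2 * r) := by gcongr; linarith
        _ = K * (2 * r) := by rw [hK]; ring
    exact le_of_mul_le_mul_left h1 hK0
  have hmin : ∀ u ∈ A, ‖w - z‖ ^ 2 ≤ ‖u - z‖ ^ 2 + η ^ 3 / (2 * r) := by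
    intro u hu
    have h1 := hwm u hu
    simp only [h] at h1
    have h2 : ‖u - y‖ - N ≤ c1 * (‖u - y‖ ^ 2 - N ^ 2) := by
      rw [hc1, one_div_mul_eq_div, le_div_iff₀ (by positivity)]
      nlinarith [sq_nonneg (‖u - y‖ - N)]
    have h3 : a * (ψ u - p) ≤ c2 * (‖u - x0‖ ^ 2 - ‖w - x0‖ ^ 2) := by
      have e : ‖u - x0‖ ^ 2 - ‖w - x0‖ ^ 2 = ψ u ^ 2 - p ^ 2 := by
        rw [hp, hψsq, hψsq]; ring
      rw [e, hc2, div_mul_eq_mul_div, le_div_iff₀ (by positivity)]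
      nlinarith [mul_nonneg ha0.le (sq_nonneg (ψ u - p))]
    have e1 : ∀ v : X, ‖u - v‖ ^ 2 = ‖u - w‖ ^ 2 - 2 * inner ℝ (u - w) (v - w) + ‖w - v‖ ^ 2 := by
      intro v
      rw [show u - v = (u - w) - (v - w) by abel, norm_sub_sq_real, norm_sub_rev v w]
    have e2 : K * inner ℝ (u - w) (z - w) =
        c1 * inner ℝ (u - w) (y - w) + c2 * inner ℝ (u - w) (x0 - w) := by
      rw [← inner_smul_right, hKz, inner_add_right, inner_smul_right, inner_smul_right]
    have h4 : K * ‖w - z‖ ^ 2 ≤ K * ‖u - z‖ ^ 2 + ε := by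
      have q1 := e1 y
      have q2 := e1 x0
      rw [e1 z]
      rw [q1] at h2
      rw [q2] at h3
      rw [← hN] at h2
      have : K * ‖u - w‖ ^ 2 = c1 * ‖u - w‖ ^ 2 + c2 * ‖u - w‖ ^ 2 := by rw [hK]; ring
      linarith
    have h5 : ε ≤ K * (ε * (4 * r)) := by
      have : 1 / (4 * r) ≤ K := by linarith
      rw [div_le_iff₀ (by positivity)] at this
      nlinarith
    have h6 : K * ‖w - z‖ ^ 2 ≤ K * (‖u - z‖ ^ 2 + ε * (4 * r)) := by linarith
    have := le_of_mul_le_mul_left h6 hK0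
    linarith
  obtain ⟨x', z', hx', hd1, hd2, hmin'⟩ :=
    aux_proj A hA (2 * r) η (by positivity) hη0 w z hw hwz hmin
  refine ⟨x', hx', ?_, ?_⟩
  · have h1 := norm_sub_le_norm_sub_add_norm_sub x' w x0
    rw [norm_sub_rev x' w] at h1
    have : a * ‖x' - x0‖ < a * (α * r) := by nlinarith
    exact lt_of_mul_lt_mul_left this ha0.le
  · have hmem : (2 * K) • (z' - x') ∈ proxCone A x' := by
      refine ⟨2 * K, z', by positivity, ?_, rfl⟩
      apply le_antisymm
      · refine (Metric.le_infDist ⟨x', hx'⟩).2 fun u hu => ?_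
        have := hmin' u hu
        rwa [dist_comm, dist_comm z', dist_eq_norm, dist_eq_norm]
      · exact Metric.infDist_le_dist_of_mem hx'
    refine (Metric.infDist_le_dist_of_mem hmem).trans_lt ?_
    have hN' := hsA x' hx'
    set N' := ‖x' - y‖ with hN'def
    have hN'0 : 0 < N' := hs.trans_le hN'
    have hNN : |N - N'| ≤ 2 * η := by
      refine (abs_norm_sub_norm_le _ _).trans ?_
      rwa [sub_sub_sub_cancel_right]
    have hunit : ‖N'⁻¹ • (y - x') - N⁻¹ • (y - w)‖ ≤ 4 * η / s := by
      have e : N'⁻¹ • (y - x') - N⁻¹ • (y - w)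
          = (N⁻¹ * (N - N')) • (N'⁻¹ • (y - x')) + N⁻¹ • (w - x') := by
        have : N⁻¹ * (N - N') * N'⁻¹ = N'⁻¹ - N⁻¹ := by field_simp
        rw [smul_smul, this]; module
      have n1 : ‖N'⁻¹ • (y - x')‖ = 1 := by
        rw [norm_smul, norm_sub_rev, ← hN'def, norm_inv, Real.norm_eq_abs, abs_of_pos hN'0]
        field_simp
      rw [e]
      refine (norm_add_le _ _).trans ?_
      rw [norm_smul, n1, norm_smul, norm_mul, norm_inv, Real.norm_eq_abs, Real.norm_eq_abs,
        abs_of_pos hN0]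
      have : N⁻¹ ≤ s⁻¹ := inv_anti₀ hs hNs
      calc N⁻¹ * |N - N'| * 1 + N⁻¹ * ‖w - x'‖ ≤ s⁻¹ * (2 * η) * 1 + s⁻¹ * (2 * η) := by gcongr
        _ = 4 * η / s := by field_simp; ring
    have hgrad : (2 * K) • (z - w) = N⁻¹ • (y - w) + (a / p) • (x0 - w) := by
      rw [mul_smul, hKz, smul_add, smul_smul, smul_smul, hc1, hc2]
      congr 2 <;> field_simp
    have hap : ‖(a / p) • (x0 - w)‖ ≤ a := by
      rw [norm_smul, Real.norm_eq_abs, abs_of_pos (by positivity), norm_sub_rev, div_mul_eq_mul_div,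
        div_le_iff₀ hp0]
      have := hψn w
      gcongr
    have hK2 : ‖(2 * K) • ((z - z') - (w - x'))‖ ≤ η * (4 / s + 4 * a / δ) := by
      rw [norm_smul, Real.norm_eq_abs, abs_of_pos (by positivity)]
      have : ‖(z - z') - (w - x')‖ ≤ 4 * η := (norm_sub_le _ _).trans (by linarith)
      calc 2 * K * ‖(z - z') - (w - x')‖ ≤ 2 * (1 / (2 * s) + a / (2 * δ)) * (4 * η) := by
            gcongr
            rw [hK]; linarith
        _ = η * (4 / s + 4 * a / δ) := by field_simp
    have e : N'⁻¹ • (y - x') - (2 * K) • (z' - x') =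
        (N'⁻¹ • (y - x') - N⁻¹ • (y - w)) - (a / p) • (x0 - w)
          + (2 * K) • ((z - z') - (w - x')) := by
      have : (2 * K) • ((z - z') - (w - x')) = (2 * K) • (z - w) - (2 * K) • (z' - x') := by module
      rw [this, hgrad]; abel
    rw [dist_eq_norm, e]
    have t1 := norm_add_le ((N'⁻¹ • (y - x') - N⁻¹ • (y - w)) - (a / p) • (x0 - w))
      ((2 * K) • ((z - z') - (w - x')))
    have t2 := norm_sub_le (N'⁻¹ • (y - x') - N⁻¹ • (y - w)) ((a / p) • (x0 - w))
    have t3 : 4 * η / s + η * (4 / s + 4 * a / δ) = η * (8 / s + 4 * a / δ) := by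
      field_simp; ring
    linarith

lemma aux_ang {X : Type*} [NormedAddCommGroup X] [InnerProductSpace ℝ X]
    (B : Set X) (α : ℝ) (h0 : 0 < α) (hα1 : α < 1) (x0 y x : X)
    (hy : dist x0 y = Metric.infDist x0 B) (hxy : 0 < ‖x - y‖)
    (hlt : ‖x - x0‖ < α * ‖x0 - y‖) :
    Metric.infDist (‖x - y‖⁻¹ • (x - y)) (proxCone B y) < α := by
  set v := x - y with hv
  set w := x0 - y with hw
  have hxx : x - x0 = v - w := by rw [hv, hw]; abel
  rw [hxx] at hlt
  have hr0 : 0 < ‖w‖ := by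
    by_contra hc
    have : ‖w‖ = 0 := le_antisymm (not_lt.1 hc) (norm_nonneg _)
    rw [this, mul_zero] at hlt
    exact absurd hlt (not_lt.2 (norm_nonneg _))
  have hsq : ‖v - w‖ ^ 2 < α ^ 2 * ‖w‖ ^ 2 := by
    rw [← mul_pow]; gcongr
  rw [norm_sub_sq_real] at hsq
  have hα2 : α ^ 2 < 1 := by nlinarith
  have hin : 0 < inner ℝ v w := by nlinarith [sq_nonneg ‖v‖, sq_pos_of_pos hr0]
  set i := inner ℝ v w with hi
  have hmem : (i / (‖v‖ * ‖w‖ ^ 2)) • w ∈ proxCone B y :=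
    ⟨_, x0, by positivity, hy, rfl⟩
  refine (Metric.infDist_le_dist_of_mem hmem).trans_lt ?_
  rw [dist_eq_norm]
  refine lt_of_pow_lt_pow_left₀ 2 h0.le ?_
  rw [norm_sub_sq_real, norm_smul, norm_smul, inner_smul_left, inner_smul_right, ← hi,
    Real.norm_eq_abs, Real.norm_eq_abs, abs_of_pos (by positivity), abs_of_pos (by positivity)]
  have e : (‖v‖⁻¹ * ‖v‖) ^ 2 - 2 * ((starRingEnd ℝ) ‖v‖⁻¹ * (i / (‖v‖ * ‖w‖ ^ 2) * i)) +
      (i / (‖v‖ * ‖w‖ ^ 2) * ‖w‖) ^ 2 = 1 - i ^ 2 / (‖v‖ ^ 2 * ‖w‖ ^ 2) := by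
    simp only [conj_trivial]
    field_simp
    ring
  rw [e, sub_lt_comm, lt_div_iff₀ (by positivity)]
  -- (1 - α²) V² W² < i², from V² + (1-α²) W² < 2 i
  have hβ : 0 < 1 - α ^ 2 := by linarith
  have hq : ‖v‖ ^ 2 + (1 - α ^ 2) * ‖w‖ ^ 2 < 2 * i := by linarith
  have hpos : 0 < ‖v‖ ^ 2 + (1 - α ^ 2) * ‖w‖ ^ 2 := by positivity
  have : (‖v‖ ^ 2 + (1 - α ^ 2) * ‖w‖ ^ 2) ^ 2 < (2 * i) ^ 2 := by gcongr
  nlinarith [sq_nonneg (‖v‖ ^ 2 - (1 - α ^ 2) * ‖w‖ ^ 2)]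

theorem stmt_10 (A B : Set X) (hA : IsClosed A) (hB : IsClosed B)
    (α : ℝ) (hα : α ∈ Set.Ioo (0 : ℝ) 1)
    (hcond1 : ∀ x ∈ A, x ∉ B → ∀ y ∈ B, setDist A B < Metric.infDist y A →
      α ≤ max (Metric.infDist (‖x - y‖⁻¹ • (x - y)) (proxCone B y))
              (Metric.infDist (‖x - y‖⁻¹ • (y - x)) (proxCone A x)))
    (hd : 0 < setDist A B)
    (x : ℕ → X) (hx0 : x 0 ∈ A)
    (hodd : ∀ n, x (2 * n + 1) ∈ B ∧
      dist (x (2 * n)) (x (2 * n + 1)) = Metric.infDist (x (2 * n)) B)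
    (heven : ∀ n, x (2 * n + 2) ∈ A ∧
      dist (x (2 * n + 1)) (x (2 * n + 2)) = Metric.infDist (x (2 * n + 1)) A) :
    ∃ n : ℕ, (n : ℤ) ≤ ⌊Real.logb (1 - α ^ 2) (setDist A B / Metric.infDist (x 0) B)⌋ ∧
      Metric.infDist (x (2 * n + 1)) A = setDist A B := by
  obtain ⟨hα0, hα1⟩ := hα
  have hA' : ∀ n, x (2 * n) ∈ A := by
    intro n
    cases n with
    | zero => exact hx0
    | succ n => exact (heven n).1
  have hD : ∀ a ∈ A, ∀ b ∈ B, setDist A B ≤ dist a b := by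
    intro a ha b hb
    exact csInf_le ⟨0, by rintro _ ⟨a, -, b, -, rfl⟩; exact dist_nonneg⟩ ⟨a, ha, b, hb, rfl⟩
  have hDA : ∀ b ∈ B, setDist A B ≤ Metric.infDist b A := fun b hb =>
    (Metric.le_infDist ⟨x 0, hx0⟩).2 fun a ha => by rw [dist_comm]; exact hD a ha b hb
  have hdisj : ∀ a ∈ A, a ∉ B := by
    intro a ha hb
    have := hD a ha a hb
    rw [dist_self] at this
    linarith
  set D := setDist A B with hDdef
  have hβ : 0 < 1 - α ^ 2 := by nlinarith
  have hβ1 : 1 - α ^ 2 < 1 := by nlinarith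
  have onestep : ∀ n, Metric.infDist (x (2 * n + 1)) A ≠ D →
      Metric.infDist (x (2 * n + 1)) A ≤ (1 - α ^ 2) * Metric.infDist (x (2 * n)) B := by
    intro n hn
    obtain ⟨hyB, hyd⟩ := hodd n
    have hgt : D < Metric.infDist (x (2 * n + 1)) A := lt_of_le_of_ne (hDA _ hyB) (Ne.symm hn)
    by_contra hc
    push Not at hc
    rw [← hyd, dist_eq_norm] at hc
    obtain ⟨u, hu, hu1, hu2⟩ := aux_key A hA α _ hα0 (x (2 * n)) (x (2 * n + 1)) (hA' n)
      (hd.trans hgt) (fun u hu => by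
        rw [← dist_eq_norm, dist_comm]; exact Metric.infDist_le_dist_of_mem hu) hα1 hc
    have hpos : 0 < ‖u - x (2 * n + 1)‖ := by
      rw [← dist_eq_norm]; exact hd.trans_le (hD u hu _ hyB)
    have h1 := aux_ang B α hα0 hα1 (x (2 * n)) (x (2 * n + 1)) u hyd hpos hu1
    have h2 := hcond1 u hu (hdisj u hu) _ hyB hgt
    exact absurd h2 (not_le.2 (max_lt h1 hu2))
  set r0 := Metric.infDist (x 0) B with hr0
  have hr0D : D ≤ r0 := by
    have h := (hodd 0).2
    have := hD _ (hA' 0) _ (hodd 0).1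
    rw [h] at this
    exact this
  have hr0pos : 0 < r0 := hd.trans_le hr0D
  have hq0 : 0 < D / r0 := by positivity
  have hq1 : D / r0 ≤ 1 := (div_le_one hr0pos).2 hr0D
  have hlog : 0 ≤ Real.logb (1 - α ^ 2) (D / r0) :=
    Real.logb_nonneg_of_base_lt_one hβ hβ1 hq0 hq1
  set L := Real.logb (1 - α ^ 2) (D / r0) with hL
  by_contra hcon
  push Not at hcon
  obtain ⟨N, hN⟩ := Int.eq_ofNat_of_zero_le (Int.floor_nonneg.2 hlog)
  have hfail : ∀ n : ℕ, n ≤ N → Metric.infDist (x (2 * n + 1)) A ≠ D := by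
    intro n hn
    apply hcon
    rw [hN]; exact_mod_cast hn
  have hind : ∀ n : ℕ, n ≤ N →
      Metric.infDist (x (2 * n + 1)) A ≤ (1 - α ^ 2) ^ (n + 1) * r0 := by
    intro n
    induction n with
    | zero =>
      intro hn
      simpa using onestep 0 (hfail 0 hn)
    | succ n ih =>
      intro hn
      have h1 := ih (by omega)
      have h2 := onestep (n + 1) (hfail _ hn)
      have h3 : Metric.infDist (x (2 * (n + 1))) B ≤ Metric.infDist (x (2 * n + 1)) A := by
        rw [← (heven n).2, dist_comm]
        exact Metric.infDist_le_dist_of_mem (hodd n).1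
      calc _ ≤ _ := h2
        _ ≤ (1 - α ^ 2) * ((1 - α ^ 2) ^ (n + 1) * r0) := by
          gcongr
          exact h3.trans h1
        _ = _ := by ring
  have h1 := hind N le_rfl
  have h2 : D < Metric.infDist (x (2 * N + 1)) A :=
    lt_of_le_of_ne (hDA _ (hodd N).1) (Ne.symm (hfail N le_rfl))
  have h3 : D / r0 < (1 - α ^ 2) ^ (N + 1) := by
    rw [div_lt_iff₀ hr0pos]; linarith
  have h4 : ((N + 1 : ℕ) : ℝ) < L := by
    rw [hL, Real.lt_logb_iff_rpow_lt_of_base_lt_one hβ hβ1 hq0, Real.rpow_natCast]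
    exact h3
  have h5 := Int.lt_floor_add_one L
  rw [hN] at h5
  push_cast at h4 h5
  linarith
end

section
/- Let A, B be closed subsets of a Hilbert space with A ∩ B possibly nonempty and d(A,B) = 0, satisfying Condition 1 with constant α ∈ (0,1). Then any alternating projection sequence (x_n) satisfies ‖x_{n+1} − x_n‖ ≤ (1−α²)^n ‖x_1 − x_0‖ for all n ≥ 0. -/
open Metric
open scoped InnerProductSpace

variable {X : Type*} [NormedAddCommGroup X] [InnerProductSpace ℝ X] [CompleteSpace X]

theorem svp (A : Set X) (hA : IsClosed A) (G : X → ℝ) (hG : Continuous G) (hG0 : ∀ z, 0 ≤ G z)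
    (a : X) (ha : a ∈ A) (δ : ℝ) (hδ : 0 < δ) :
    ∃ w ∈ A, ∃ y : X, ‖y‖ ≤ δ ∧ G w ≤ G a ∧
      ∀ z ∈ A, G w ≤ G z + 2 * ⟪y, z - w⟫_ℝ + δ * ‖z - w‖ ^ 2 := by
  have pick : ∀ (F : X → ℝ) (z0 : X) (ε : ℝ), ∃ z1 : X, (∀ z, 0 ≤ F z) → z0 ∈ A → 0 < ε →
      z1 ∈ A ∧ F z1 ≤ F z0 ∧ ∀ z ∈ A, F z1 ≤ F z + ε := by
    intro F z0 ε
    by_cases h : (∀ z, 0 ≤ F z) ∧ z0 ∈ A ∧ 0 < ε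
    · obtain ⟨h1, h2, h3⟩ := h
      by_cases h4 : ∀ z ∈ A, F z0 ≤ F z + ε
      · exact ⟨z0, fun _ _ _ => ⟨h2, le_rfl, h4⟩⟩
      · push Not at h4
        obtain ⟨z2, hz2, hlt⟩ := h4
        have hne : (F '' A).Nonempty := ⟨F z0, z0, h2, rfl⟩
        have hbd : BddBelow (F '' A) := ⟨0, by rintro _ ⟨z, _, rfl⟩; exact h1 z⟩
        obtain ⟨_, ⟨z1, hz1, rfl⟩, hz1lt⟩ := exists_lt_of_csInf_lt hne
          (show sInf (F '' A) < sInf (F '' A) + ε by linarith)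
        have hle : ∀ z ∈ A, F z1 ≤ F z + ε := fun z hz => by
          have := csInf_le hbd ⟨z, hz, rfl⟩
          linarith
        refine ⟨z1, fun _ _ _ => ⟨hz1, ?_, hle⟩⟩
        have := hle z2 hz2
        linarith
    · exact ⟨z0, fun h1 h2 h3 => absurd ⟨h1, h2, h3⟩ h⟩
  choose pk hpk using pick
  let d : ℕ → ℝ := fun n => δ / 2 * (1 / 2) ^ n
  let e : ℕ → ℝ := fun n => d n * ((1 / 2) ^ n) ^ 2
  have hd : ∀ n, 0 < d n := fun n => by positivity
  have he : ∀ n, 0 < e n := fun n => by positivity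
  let st : ℕ → (X → ℝ) × X := fun n => Nat.rec (G, pk G a (e 0))
    (fun n s => (fun z => s.1 z + d n * ‖z - s.2‖ ^ 2,
      pk (fun z => s.1 z + d n * ‖z - s.2‖ ^ 2) s.2 (e (n + 1)))) n
  let F : ℕ → X → ℝ := fun n => (st n).1
  let u : ℕ → X := fun n => (st n).2
  have hF0 : F 0 = G := rfl
  have hu0 : u 0 = pk G a (e 0) := rfl
  have hFs : ∀ n z, F (n + 1) z = F n z + d n * ‖z - u n‖ ^ 2 := fun n z => rfl
  have hus : ∀ n, u (n + 1) = pk (F (n + 1)) (u n) (e (n + 1)) := fun n => rfl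
  clear_value F u
  clear st
  have hFn : ∀ n z, 0 ≤ F n z := by
    intro n
    induction n with
    | zero => intro z; rw [hF0]; exact hG0 z
    | succ n ih => intro z; rw [hFs]; have := ih z; have := hd n; positivity
  have hFc : ∀ n, Continuous (F n) := by
    intro n
    induction n with
    | zero => rw [hF0]; exact hG
    | succ n ih =>
      have : F (n + 1) = fun z => F n z + d n * ‖z - u n‖ ^ 2 := funext (hFs n)
      rw [this]; fun_prop
  have hu0' := hpk G a (e 0) hG0 ha (he 0)
  rw [← hu0] at hu0'
  have huA : ∀ n, u n ∈ A := by
    intro n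
    induction n with
    | zero => exact hu0'.1
    | succ n ih => rw [hus]; exact (hpk _ _ _ (hFn _) ih (he _)).1
  have hstep : ∀ n, F (n + 1) (u (n + 1)) ≤ F n (u n) := by
    intro n
    have := (hpk _ _ _ (hFn (n + 1)) (huA n) (he (n + 1))).2.1
    rw [← hus] at this
    have h2 := hFs n (u n)
    simp at h2
    linarith
  have hmin : ∀ n, ∀ z ∈ A, F n (u n) ≤ F n z + e n := by
    intro n
    cases n with
    | zero => rw [hF0]; exact hu0'.2.2
    | succ n => 
      have := (hpk _ _ _ (hFn (n + 1)) (huA n) (he (n + 1))).2.2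
      rwa [← hus] at this
  have hanti : Antitone (fun n => F n (u n)) := antitone_nat_of_succ_le hstep
  have hmono : ∀ z, Monotone (fun n => F n z) := fun z => monotone_nat_of_le_succ (fun n => by
    rw [hFs]; have := hd n; nlinarith [sq_nonneg ‖z - u n‖])
  have hS : ∀ n, ∀ z ∈ A, F (n + 1) z ≤ F n (u n) → ‖z - u n‖ ≤ (1 / 2) ^ n := by
    intro n z hz h
    have h1 := hmin n z hz
    rw [hFs] at h
    have h2 : d n * ‖z - u n‖ ^ 2 ≤ d n * ((1 / 2) ^ n) ^ 2 := by
      change _ ≤ e n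
      linarith
    have h3 := le_of_mul_le_mul_left h2 (hd n)
    exact le_of_sq_le_sq h3 (by positivity)
  have hSm : ∀ n m, n < m → F (n + 1) (u m) ≤ F n (u n) := fun n m h =>
    (hmono (u m) (show n + 1 ≤ m from h)).trans (hanti h.le)
  have hcau : CauchySeq u := by
    refine cauchySeq_of_le_geometric (1 / 2) 1 (by norm_num) (fun n => ?_)
    rw [dist_comm, dist_eq_norm, one_mul]
    exact hS n _ (huA _) (hSm n _ (Nat.lt_succ_self n))
  obtain ⟨w, hw⟩ := cauchySeq_tendsto_of_complete hcau
  have hwA : w ∈ A := hA.mem_of_tendsto hw (Filter.Eventually.of_forall huA)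
  have hwS : ∀ n, F (n + 1) w ≤ F n (u n) := fun n =>
    le_of_tendsto (((hFc (n + 1)).tendsto w).comp hw)
      ((Filter.eventually_gt_atTop n).mono (fun m hm => hSm n m hm))
  have hwu : ∀ n, ‖w - u n‖ ≤ (1 / 2) ^ n := fun n => hS n w hwA (hwS n)
  have hdsum : HasSum d δ := by
    have := (hasSum_geometric_two).mul_left (δ / 2)
    simpa [d] using this
  have hnb : ∀ n, ‖d n • (w - u n)‖ ≤ d n := fun n => by
    rw [norm_smul, Real.norm_of_nonneg (hd n).le]
    have h1 : ((1 : ℝ) / 2) ^ n ≤ 1 := pow_le_one₀ (by norm_num) (by norm_num)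
    have := hwu n
    have := hd n
    nlinarith
  have hsumm : Summable (fun n => d n • (w - u n)) :=
    Summable.of_norm_bounded hdsum.summable hnb
  refine ⟨w, hwA, ∑' n, d n • (w - u n), tsum_of_norm_bounded hdsum hnb, ?_, ?_⟩
  · have h1 := hwS 0
    have h2 := hmono w (Nat.zero_le 1)
    simp only [hF0] at h1 h2
    simp only [zero_add] at h1
    exact h2.trans (h1.trans hu0'.2.1)
  · intro z hz
    by_cases hzw : z = w
    · subst hzw; simp
    have hexp : ∀ n, F n z - F n w = G z - G w + 2 * ⟪∑ k ∈ Finset.range n, d k • (w - u k), z - w⟫_ℝ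
        + (∑ k ∈ Finset.range n, d k) * ‖z - w‖ ^ 2 := by
      intro n
      induction n with
      | zero => simp [hF0]
      | succ n ih =>
        rw [hFs, hFs, Finset.sum_range_succ, Finset.sum_range_succ, inner_add_left,
          real_inner_smul_left]
        have : ‖z - u n‖ ^ 2 = ‖w - u n‖ ^ 2 + 2 * ⟪w - u n, z - w⟫_ℝ + ‖z - w‖ ^ 2 := by
          rw [← norm_add_sq_real]; congr 2; abel
        rw [this]
        linarith
    have hlim : Filter.Tendsto (fun n => F n z - F n w) Filter.atTop
        (nhds (G z - G w + 2 * ⟪∑' n, d n • (w - u n), z - w⟫_ℝ + δ * ‖z - w‖ ^ 2)) := by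
      simp_rw [hexp]
      refine Filter.Tendsto.add (Filter.Tendsto.add tendsto_const_nhds
        (Filter.Tendsto.const_mul 2 ?_)) (Filter.Tendsto.mul_const _ hdsum.tendsto_sum_nat)
      exact (hsumm.hasSum.tendsto_sum_nat).inner tendsto_const_nhds
    have hev : ∀ᶠ n in Filter.atTop, 0 ≤ F (n + 1) z - F (n + 1) w := by
      have h1 : Filter.Tendsto (fun n => ‖z - u n‖) Filter.atTop (nhds ‖z - w‖) :=
        (tendsto_const_nhds.sub hw).norm
      have h2 : Filter.Tendsto (fun n : ℕ => ((1 : ℝ) / 2) ^ n) Filter.atTop (nhds 0) :=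
        tendsto_pow_atTop_nhds_zero_of_lt_one (by norm_num) (by norm_num)
      have h3 : 0 < ‖z - w‖ := norm_pos_iff.2 (sub_ne_zero.2 hzw)
      filter_upwards [h2.eventually_lt h1 h3] with n hn
      by_contra hc
      have := hS n z hz (by have := hwS n; linarith)
      linarith
    have := ge_of_tendsto (hlim.comp (Filter.tendsto_add_atTop_nat 1)) hev
    linarith

theorem sqrt_quad (s m h : ℝ) (hm : 0 < m) (hs : s ^ 2 = m ^ 2 + h) : s ≤ m + h / (2 * m) := by
  have h1 : h / (2 * m) = (s ^ 2 - m ^ 2) / (2 * m) := by rw [hs]; ring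
  rw [h1, ← sub_nonneg]
  have : m + (s ^ 2 - m ^ 2) / (2 * m) - s = (s - m) ^ 2 / (2 * m) := by field_simp; ring
  rw [this]; positivity

theorem prox_of_quad (A : Set X) (w : X) (hw : w ∈ A) (p : X) (C : ℝ) (hC : 0 < C)
    (h : ∀ z ∈ A, ⟪p, z - w⟫_ℝ ≤ C * ‖z - w‖ ^ 2) : p ∈ proxCone A w := by
  refine ⟨2 * C, w + (2 * C)⁻¹ • p, by positivity, ?_, ?_⟩
  · apply le_antisymm
    · rw [Metric.le_infDist ⟨w, hw⟩]
      intro z hz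
      rw [dist_eq_norm, dist_eq_norm]
      apply le_of_sq_le_sq _ (norm_nonneg _)
      have e1 : w + (2 * C)⁻¹ • p - w = (2 * C)⁻¹ • p := by abel
      have e2 : w + (2 * C)⁻¹ • p - z = (2 * C)⁻¹ • p - (z - w) := by abel
      rw [e1, e2, norm_sub_sq_real ((2 * C)⁻¹ • p), real_inner_smul_left]
      have := mul_le_mul_of_nonneg_left (h z hz) (show 0 ≤ 2 * (2 * C)⁻¹ by positivity)
      have e3 : 2 * (2 * C)⁻¹ * (C * ‖z - w‖ ^ 2) = ‖z - w‖ ^ 2 := by field_simp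
      linarith
    · exact Metric.infDist_le_dist_of_mem hw
  · rw [add_sub_cancel_left, smul_smul, mul_inv_cancel₀ (by positivity), one_smul]

theorem ray_dist (P Q : X) (m r κ : ℝ) (hm : 0 < m) (hr : 0 < r) (hP : ‖P‖ = m) (hQ : ‖Q‖ = r)
    (hκ0 : 0 ≤ κ) (hκ1 : κ < 1) (h : ‖P - Q‖ ≤ κ * r) :
    ∃ l : ℝ, 0 ≤ l ∧ ‖m⁻¹ • P - l • Q‖ ≤ κ := by
  have h2 : ‖P - Q‖ ^ 2 ≤ (κ * r) ^ 2 := by gcongr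
  rw [norm_sub_sq_real, hP, hQ] at h2
  set t := ⟪P, Q⟫_ℝ with ht
  have hc : 0 < (1 - κ ^ 2) * r ^ 2 := by
    have : 0 < 1 - κ ^ 2 := by nlinarith
    positivity
  have h3 : m ^ 2 + (1 - κ ^ 2) * r ^ 2 ≤ 2 * t := by nlinarith
  have ht0 : 0 ≤ t := by nlinarith
  refine ⟨t / (r ^ 2 * m), by positivity, ?_⟩
  apply le_of_sq_le_sq _ hκ0
  rw [norm_sub_sq_real, norm_smul, norm_smul, real_inner_smul_left, real_inner_smul_right, ← ht,
    hP, hQ, Real.norm_of_nonneg (by positivity), Real.norm_of_nonneg (by positivity)]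
  have e : (m⁻¹ * m) ^ 2 - 2 * (m⁻¹ * (t / (r ^ 2 * m) * t)) + (t / (r ^ 2 * m) * r) ^ 2
      = 1 - t ^ 2 / (r ^ 2 * m ^ 2) := by
    field_simp
    ring
  rw [e]
  have h4 : (1 - κ ^ 2) ≤ t ^ 2 / (r ^ 2 * m ^ 2) := by
    rw [le_div_iff₀ (by positivity)]
    have h5 : (m ^ 2 + (1 - κ ^ 2) * r ^ 2) ^ 2 ≤ (2 * t) ^ 2 := by gcongr
    nlinarith [sq_nonneg (m ^ 2 - (1 - κ ^ 2) * r ^ 2)]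
  linarith

theorem one_step (A B : Set X) (hA : IsClosed A) 
    (α : ℝ) (hα : α ∈ Set.Ioo (0 : ℝ) 1)
    (hcond1 : ∀ x ∈ A, x ∉ B → ∀ y ∈ B, y ∉ A →
      α ≤ max (Metric.infDist (‖x - y‖⁻¹ • (x - y)) (proxCone B y))
              (Metric.infDist (‖x - y‖⁻¹ • (y - x)) (proxCone A x)))
    (a b : X) (ha : a ∈ A) (hb : b ∈ B) (hab : dist a b = Metric.infDist a B) :
    Metric.infDist b A ≤ (1 - α ^ 2) * dist a b := by
  obtain ⟨hα0, hα1⟩ := hα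
  have hα2 : 0 < 1 - α ^ 2 := by nlinarith
  by_cases hbA : b ∈ A
  · rw [Metric.infDist_zero_of_mem hbA]; positivity
  by_contra! hcon
  have hr : 0 < dist a b := dist_pos.2 (fun h => hbA (h ▸ ha))
  set r := dist a b with hrdef
  set D := Metric.infDist b A with hD
  obtain ⟨κ, hκ0, hκα, hκ⟩ : ∃ κ : ℝ, 0 < κ ∧ κ < α ∧ r - D < κ ^ 2 * r := by
    have hc : Filter.Tendsto (fun k : ℝ => k ^ 2 * r) (nhdsWithin α (Set.Iio α))
        (nhds (α ^ 2 * r)) :=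
      (Continuous.tendsto (by fun_prop : Continuous fun k : ℝ => k ^ 2 * r) α).mono_left
        nhdsWithin_le_nhds
    have h1 := hc.eventually_const_lt (show r - D < α ^ 2 * r by linarith)
    have h2 : ∀ᶠ k in nhdsWithin α (Set.Iio α), k ∈ Set.Ioo 0 α := Ioo_mem_nhdsLT hα0
    obtain ⟨k, hk1, hk2⟩ := (h1.and h2).exists
    exact ⟨k, hk2.1, hk2.2, hk1⟩
  obtain ⟨ε, hε, hκε⟩ : ∃ ε : ℝ, 0 < ε ∧ κ * ε < D + κ ^ 2 * r - r := by
    refine ⟨(D + κ ^ 2 * r - r) / (2 * κ), div_pos (by linarith) (by positivity), ?_⟩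
    have : κ * ((D + κ ^ 2 * r - r) / (2 * κ)) = (D + κ ^ 2 * r - r) / 2 := by field_simp
    rw [this]; linarith
  obtain ⟨w, hwA, y, hy, hGw, hmin⟩ := svp A hA
    (fun z => ‖z - b‖ + κ * √(‖z - a‖ ^ 2 + ε ^ 2)) (by fun_prop) (fun z => by positivity)
    a ha ((α - κ) / 4) (by linarith)
  rw [sub_self, norm_zero, ← dist_eq_norm a b, ← hrdef] at hGw
  have hsq : √((0 : ℝ) ^ 2 + ε ^ 2) = ε := by
    rw [zero_pow (by norm_num), zero_add, Real.sqrt_sq hε.le]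
  rw [hsq] at hGw
  have hDw : D ≤ ‖w - b‖ := by
    rw [← dist_eq_norm, dist_comm]; exact Metric.infDist_le_dist_of_mem hwA
  set S := √(‖w - a‖ ^ 2 + ε ^ 2) with hSdef
  have hSsq : S ^ 2 = ‖w - a‖ ^ 2 + ε ^ 2 := Real.sq_sqrt (by positivity)
  have hS0 : 0 < S := Real.sqrt_pos.2 (by positivity)
  have hwaS : ‖w - a‖ ≤ S := Real.le_sqrt_of_sq_le (by nlinarith)
  have hSlt : S < κ * r := by
    have : κ * S < κ * (κ * r) := by nlinarith
    exact lt_of_mul_lt_mul_left this hκ0.le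
  have hwa : ‖w - a‖ < κ * r := hwaS.trans_lt hSlt
  have hwB : w ∉ B := by
    intro h
    have := Metric.infDist_le_dist_of_mem (x := a) h
    rw [← hab, dist_comm, dist_eq_norm] at this
    nlinarith
  have hm : 0 < ‖w - b‖ := norm_pos_iff.2 (sub_ne_zero.2 (fun h => hbA (h ▸ hwA)))
  set m := ‖w - b‖ with hmdef
  have key := hcond1 w hwA hwB b hb hbA
  rw [← hmdef] at key
  have k1 : Metric.infDist (m⁻¹ • (w - b)) (proxCone B b) < α := by
    obtain ⟨l, hl, hle⟩ := ray_dist (w - b) (a - b) m r κ hm hr hmdef.symm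
      (dist_eq_norm a b).symm hκ0.le (by linarith) (by
        rw [sub_sub_sub_cancel_right]; exact hwa.le)
    have hmem : l • (a - b) ∈ proxCone B b := ⟨l, a, hl, hab, rfl⟩
    have := Metric.infDist_le_dist_of_mem (x := m⁻¹ • (w - b)) hmem
    rw [dist_eq_norm] at this
    linarith
  have k2 : Metric.infDist (m⁻¹ • (b - w)) (proxCone A w) < α := by
    have hmem : m⁻¹ • (b - w) - ((κ / S) • (w - a) + (2 : ℝ) • y) ∈ proxCone A w := by
      refine prox_of_quad A w hwA _ (1 / (2 * m) + κ / (2 * S) + (α - κ) / 4)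
        (by have : 0 < (α - κ) / 4 := by linarith
            positivity) ?_
      intro z hz
      have h0 := hmin z hz
      have h1 := sqrt_quad ‖z - b‖ m (2 * ⟪w - b, z - w⟫_ℝ + ‖z - w‖ ^ 2) hm (by
        rw [hmdef, ← add_assoc, ← norm_add_sq_real]; congr 2; abel)
      have h2 := sqrt_quad (√(‖z - a‖ ^ 2 + ε ^ 2)) S (2 * ⟪w - a, z - w⟫_ℝ + ‖z - w‖ ^ 2) hS0 (by
        rw [Real.sq_sqrt (by positivity), hSsq]
        have : ‖z - a‖ ^ 2 = ‖w - a‖ ^ 2 + 2 * ⟪w - a, z - w⟫_ℝ + ‖z - w‖ ^ 2 := by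
          rw [← norm_add_sq_real]; congr 2; abel
        rw [this]; ring)
      have h3 := mul_le_mul_of_nonneg_left h2 hκ0.le
      have e1 : ⟪b - w, z - w⟫_ℝ = - ⟪w - b, z - w⟫_ℝ := by rw [← inner_neg_left, neg_sub]
      rw [inner_sub_left, inner_add_left, real_inner_smul_left, real_inner_smul_left,
        real_inner_smul_left, e1]
      have e2 : (2 * ⟪w - b, z - w⟫_ℝ + ‖z - w‖ ^ 2) / (2 * m)
          = m⁻¹ * ⟪w - b, z - w⟫_ℝ + 1 / (2 * m) * ‖z - w‖ ^ 2 := by field_simp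
      have e3 : κ * (S + (2 * ⟪w - a, z - w⟫_ℝ + ‖z - w‖ ^ 2) / (2 * S))
          = κ * S + κ / S * ⟪w - a, z - w⟫_ℝ + κ / (2 * S) * ‖z - w‖ ^ 2 := by field_simp; ring
      rw [e2] at h1
      rw [e3] at h3
      linarith
    have := Metric.infDist_le_dist_of_mem (x := m⁻¹ • (b - w)) hmem
    rw [dist_eq_norm, sub_sub_cancel] at this
    have h4 : ‖(κ / S) • (w - a) + (2 : ℝ) • y‖ ≤ κ + (α - κ) / 2 := by
      refine (norm_add_le _ _).trans ?_
      rw [norm_smul, norm_smul, Real.norm_of_nonneg (by positivity), Real.norm_of_nonneg (by norm_num)]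
      have : κ / S * ‖w - a‖ ≤ κ / S * S := by gcongr
      rw [div_mul_cancel₀ _ hS0.ne'] at this
      linarith
    linarith
  exact absurd key (not_le.2 (max_lt k1 k2))

theorem stmt_11 (A B : Set X) (hA : IsClosed A) (hB : IsClosed B)
    (α : ℝ) (hα : α ∈ Set.Ioo (0 : ℝ) 1)
    (hcond1 : ∀ x ∈ A, x ∉ B → ∀ y ∈ B, y ∉ A →
      α ≤ max (Metric.infDist (‖x - y‖⁻¹ • (x - y)) (proxCone B y))
              (Metric.infDist (‖x - y‖⁻¹ • (y - x)) (proxCone A x)))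
    (hd : setDist A B = 0)
    (x : ℕ → X) (hx0 : x 0 ∈ A)
    (hodd : ∀ n, x (2 * n + 1) ∈ B ∧
      dist (x (2 * n)) (x (2 * n + 1)) = Metric.infDist (x (2 * n)) B)
    (heven : ∀ n, x (2 * n + 2) ∈ A ∧
      dist (x (2 * n + 1)) (x (2 * n + 2)) = Metric.infDist (x (2 * n + 1)) A) :
    ∀ n : ℕ, ‖x (n + 1) - x n‖ ≤ (1 - α ^ 2) ^ n * ‖x 1 - x 0‖ := by
  have hα2 : 0 ≤ 1 - α ^ 2 := by nlinarith [hα.1, hα.2]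
  have hcond2 : ∀ x ∈ B, x ∉ A → ∀ y ∈ A, y ∉ B →
      α ≤ max (Metric.infDist (‖x - y‖⁻¹ • (x - y)) (proxCone A y))
              (Metric.infDist (‖x - y‖⁻¹ • (y - x)) (proxCone B x)) := by
    intro p hp hp' q hq hq'
    have := hcond1 q hq hq' p hp hp'
    rwa [max_comm, norm_sub_rev] at this
  have hxe : ∀ n, x (2 * n) ∈ A := by
    intro n
    cases n with
    | zero => exact hx0
    | succ n => exact (heven n).1
  have hs : ∀ n, dist (x (n + 1)) (x (n + 2)) ≤ (1 - α ^ 2) * dist (x n) (x (n + 1)) := by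
    intro n
    obtain ⟨k, rfl | rfl⟩ := Nat.even_or_odd' n
    · rw [(heven k).2]
      exact one_step A B hA α hα hcond1 _ _ (hxe k) (hodd k).1 (hodd k).2
    · have h := (hodd (k + 1)).2
      have h' : 2 * (k + 1) = 2 * k + 1 + 1 := by ring
      rw [h'] at h
      have h2 : dist (x (2 * k + 1 + 1)) (x (2 * k + 1 + 2)) = _ := h
      rw [h2]
      exact one_step B A hB α hα hcond2 _ _ (hodd k).1 (heven k).1 (heven k).2
  intro n
  induction n with
  | zero => simp
  | succ n ih =>
    have h := hs n
    rw [dist_comm, dist_eq_norm, dist_comm, dist_eq_norm] at h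
    calc _ ≤ (1 - α ^ 2) * ‖x (n + 1) - x n‖ := h
      _ ≤ (1 - α ^ 2) * ((1 - α ^ 2) ^ n * ‖x 1 - x 0‖) := by gcongr
      _ = _ := by ring
end
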